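/- Let m_N, k_N be sequences of natural numbers with p_N := m_N·k_N = o(N), and let R_N be a sequence of positive reals with R_N = o(√N) and R_N²/p_N → ∞. For each N let Z_N be the m_N×k_N upper-left block of a Haar-distributed matrix in O(N). Then limsup_{N→∞} (1/p_N)·log ℙ(‖√N·Z_N‖_F ≥ R_N) = −∞. -/

import Mathlib

open MeasureTheory Filter Matrix Asymptotics

noncomputable instance matrixMeasurableSpace {N : ℕ} :
    MeasurableSpace (Matrix (Fin N) (Fin N) ℝ) :=
  show MeasurableSpace (Fin N → Fin N → ℝ) from inferInstance

/-- Squared Frobenius norm of a matrix. -/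
def frobSq {m k : ℕ} (B : Matrix (Fin m) (Fin k) ℝ) : ℝ :=
  ∑ i, ∑ j, (B i j) ^ 2

/-- Frobenius norm of a matrix. -/
noncomputable def frobNorm {m k : ℕ} (B : Matrix (Fin m) (Fin k) ℝ) : ℝ :=
  Real.sqrt (frobSq B)

/-- The upper-left `m × k` block of an `N × N` matrix (padded with zeros if needed). -/
def blockEmb (m k : ℕ) {N : ℕ} (A : Matrix (Fin N) (Fin N) ℝ) :
    Matrix (Fin m) (Fin k) ℝ :=
  Matrix.of fun i j => if h : (i : ℕ) < N ∧ (j : ℕ) < N then A ⟨i, h.1⟩ ⟨j, h.2⟩ else 0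

section PlaneRotation

variable {N : ℕ}

/-- Rotation of the rows `i` and `a` of `A` by the angle `t`. -/
noncomputable def rotRows (i a : Fin N) (t : ℝ) (A : Matrix (Fin N) (Fin N) ℝ) :
    Matrix (Fin N) (Fin N) ℝ :=
  fun b => if b = i then Real.cos t • A i - Real.sin t • A a
    else if b = a then Real.sin t • A i + Real.cos t • A a else A b

theorem rotRows_eq_mul (i a : Fin N) (t : ℝ) (A : Matrix (Fin N) (Fin N) ℝ) :
    rotRows i a t A = rotRows i a t 1 * A := by
  ext b j
  simp only [Matrix.mul_apply, rotRows]
  split_ifs <;>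
    simp [Matrix.one_apply, sub_mul, add_mul, Finset.sum_sub_distrib, Finset.sum_add_distrib]

theorem dotProduct_rows {A : Matrix (Fin N) (Fin N) ℝ} (hA : A * Aᵀ = 1) (b b' : Fin N) :
    A b ⬝ᵥ A b' = if b = b' then 1 else 0 := by
  have := congrFun (congrFun hA b) b'
  rwa [Matrix.one_apply] at this

theorem rotRows_orthogonal {i a : Fin N} (hia : i ≠ a) (t : ℝ) {A : Matrix (Fin N) (Fin N) ℝ}
    (hA : A * Aᵀ = 1) : rotRows i a t A * (rotRows i a t A)ᵀ = 1 := by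
  have h := dotProduct_rows hA
  ext b b'
  rw [Matrix.one_apply]
  change rotRows i a t A b ⬝ᵥ rotRows i a t A b' = _
  by_cases h1 : b = i <;> by_cases h2 : b = a <;> by_cases h3 : b' = i <;>
    by_cases h4 : b' = a <;>
    simp_all [rotRows, eq_comm] <;> linarith [Real.cos_sq_add_sin_sq t]

/-- Inner product of the rows `i` and `a` restricted to the columns in `T`. -/
def rowInner (T : Finset (Fin N)) (i a : Fin N) (A : Matrix (Fin N) (Fin N) ℝ) : ℝ :=
  ∑ j ∈ T, A i j * A a j

/-- Squared Frobenius norm of the submatrix with rows in `S` and columns in `T`. -/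
def blockSq (S T : Finset (Fin N)) (A : Matrix (Fin N) (Fin N) ℝ) : ℝ :=
  ∑ i ∈ S, rowInner T i i A

theorem rowInner_self_nonneg (T : Finset (Fin N)) (i : Fin N) (A : Matrix (Fin N) (Fin N) ℝ) :
    0 ≤ rowInner T i i A :=
  Finset.sum_nonneg fun _ _ => mul_self_nonneg _

theorem rowInner_self_le_one (T : Finset (Fin N)) (i : Fin N) {A : Matrix (Fin N) (Fin N) ℝ}
    (hA : A * Aᵀ = 1) : rowInner T i i A ≤ 1 := by
  have h := dotProduct_rows hA i i
  rw [if_pos rfl] at h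
  rw [← h]
  exact Finset.sum_le_sum_of_subset_of_nonneg (Finset.subset_univ T)
    fun _ _ _ => mul_self_nonneg _

theorem two_mul_abs_rowInner_le (T : Finset (Fin N)) (i a : Fin N)
    (A : Matrix (Fin N) (Fin N) ℝ) :
    2 * |rowInner T i a A| ≤ rowInner T i i A + rowInner T a a A := by
  simp only [rowInner]
  rw [← Finset.sum_add_distrib]
  refine (mul_le_mul_of_nonneg_left (Finset.abs_sum_le_sum_abs _ _) zero_le_two).trans ?_
  rw [Finset.mul_sum]
  refine Finset.sum_le_sum fun j _ => ?_
  rw [abs_mul]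
  nlinarith [sq_nonneg (|A i j| - |A a j|), abs_mul_abs_self (A i j), abs_mul_abs_self (A a j)]

theorem abs_rowInner_le_one (T : Finset (Fin N)) (i a : Fin N) {A : Matrix (Fin N) (Fin N) ℝ}
    (hA : A * Aᵀ = 1) : |rowInner T i a A| ≤ 1 := by
  linarith [two_mul_abs_rowInner_le T i a A, rowInner_self_le_one T i hA,
    rowInner_self_le_one T a hA]

theorem blockSq_nonneg (S T : Finset (Fin N)) (A : Matrix (Fin N) (Fin N) ℝ) :
    0 ≤ blockSq S T A :=
  Finset.sum_nonneg fun _ _ => rowInner_self_nonneg _ _ _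

theorem blockSq_le (S T : Finset (Fin N)) {A : Matrix (Fin N) (Fin N) ℝ} (hA : A * Aᵀ = 1) :
    blockSq S T A ≤ S.card := by
  refine (Finset.sum_le_sum fun i _ => rowInner_self_le_one T i hA).trans ?_
  simp

theorem measurable_entry (i j : Fin N) :
    Measurable fun A : Matrix (Fin N) (Fin N) ℝ => A i j :=
  (measurable_pi_apply j).comp (measurable_pi_apply (X := fun _ : Fin N => Fin N → ℝ) i)

theorem measurable_rowInner (T : Finset (Fin N)) (i a : Fin N) :
    Measurable (rowInner (N := N) T i a) :=
  Finset.measurable_fun_sum _ fun j _ => (measurable_entry i j).mul (measurable_entry a j)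

theorem measurable_blockSq (S T : Finset (Fin N)) : Measurable (blockSq (N := N) S T) :=
  Finset.measurable_fun_sum _ fun i _ => measurable_rowInner T i i

theorem measurable_mul_left (B : Matrix (Fin N) (Fin N) ℝ) :
    Measurable fun A : Matrix (Fin N) (Fin N) ℝ => B * A :=
  measurable_pi_iff.2 fun i => measurable_pi_iff.2 fun j =>
    Finset.measurable_fun_sum Finset.univ fun l _ => (measurable_entry l j).const_mul (B i l)

theorem measurable_rotRows (i a : Fin N) (t : ℝ) : Measurable (rotRows i a t) := by
  simpa only [← rotRows_eq_mul] using measurable_mul_left (rotRows i a t 1)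

theorem measurableSet_orthogonal : MeasurableSet {A : Matrix (Fin N) (Fin N) ℝ | A * Aᵀ = 1} := by
  have : {A : Matrix (Fin N) (Fin N) ℝ | A * Aᵀ = 1} =
      ⋂ i, ⋂ j, {A | rowInner Finset.univ i j A = (1 : Matrix (Fin N) (Fin N) ℝ) i j} := by
    ext A
    simp only [Set.mem_ofPred_eq, Set.mem_iInter, ← Matrix.ext_iff]
    rfl
  rw [this]
  exact MeasurableSet.iInter fun i => MeasurableSet.iInter fun j =>
    measurable_rowInner _ i j (measurableSet_singleton _)

theorem hasDerivAt_rotRows_left (i a : Fin N) (hia : i ≠ a) (j : Fin N) (t : ℝ)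
    (A : Matrix (Fin N) (Fin N) ℝ) :
    HasDerivAt (fun t => rotRows i a t A i j) (-rotRows i a t A a j) t := by
  have := ((Real.hasDerivAt_cos t).mul_const (A i j)).sub
    ((Real.hasDerivAt_sin t).mul_const (A a j))
  refine (this.congr_of_eventuallyEq (.of_forall fun t => ?_)).congr_deriv ?_
  · simp [rotRows]
  · simp [rotRows, hia.symm]
    ring

theorem hasDerivAt_rotRows_right (i a : Fin N) (hia : i ≠ a) (j : Fin N) (t : ℝ)
    (A : Matrix (Fin N) (Fin N) ℝ) :
    HasDerivAt (fun t => rotRows i a t A a j) (rotRows i a t A i j) t := by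
  have := ((Real.hasDerivAt_sin t).mul_const (A i j)).add
    ((Real.hasDerivAt_cos t).mul_const (A a j))
  refine (this.congr_of_eventuallyEq (.of_forall fun t => ?_)).congr_deriv ?_
  · simp [rotRows, hia.symm]
  · simp [rotRows]
    ring

theorem hasDerivAt_rowInner_rotRows (T : Finset (Fin N)) {i a : Fin N} (hia : i ≠ a) (t : ℝ)
    (A : Matrix (Fin N) (Fin N) ℝ) :
    HasDerivAt (fun t => rowInner T i a (rotRows i a t A))
      (rowInner T i i (rotRows i a t A) - rowInner T a a (rotRows i a t A)) t := by
  have := HasDerivAt.fun_sum (u := T) fun j _ =>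
    (hasDerivAt_rotRows_left i a hia j t A).mul (hasDerivAt_rotRows_right i a hia j t A)
  refine this.congr_deriv ?_
  simp only [rowInner, ← Finset.sum_sub_distrib]
  exact Finset.sum_congr rfl fun j _ => by ring

theorem hasDerivAt_rowInner_self_rotRows (T : Finset (Fin N)) {i a : Fin N} (hia : i ≠ a)
    (t : ℝ) (A : Matrix (Fin N) (Fin N) ℝ) :
    HasDerivAt (fun t => rowInner T i i (rotRows i a t A))
      (-2 * rowInner T i a (rotRows i a t A)) t := by
  have := HasDerivAt.fun_sum (u := T) fun j _ =>
    (hasDerivAt_rotRows_left i a hia j t A).mul (hasDerivAt_rotRows_left i a hia j t A)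
  refine this.congr_deriv ?_
  simp only [rowInner, Finset.mul_sum]
  exact Finset.sum_congr rfl fun j _ => by ring

theorem hasDerivAt_blockSq_rotRows {S : Finset (Fin N)} (T : Finset (Fin N)) {i a : Fin N}
    (hi : i ∈ S) (ha : a ∉ S) (t : ℝ) (A : Matrix (Fin N) (Fin N) ℝ) :
    HasDerivAt (fun t => blockSq S T (rotRows i a t A))
      (-2 * rowInner T i a (rotRows i a t A)) t := by
  have hia : i ≠ a := fun h => ha (h ▸ hi)
  have hsplit : (fun t => blockSq S T (rotRows i a t A)) =
      fun t => ∑ b ∈ S.erase i, rowInner T b b A + rowInner T i i (rotRows i a t A) := by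
    ext t
    rw [blockSq, ← Finset.sum_erase_add _ _ hi]
    congr 1
    refine Finset.sum_congr rfl fun b hb => ?_
    have hbi : b ≠ i := Finset.ne_of_mem_erase hb
    have hba : b ≠ a := fun h => ha (h ▸ Finset.mem_of_mem_erase hb)
    simp [rowInner, rotRows, hbi, hba]
  rw [hsplit]
  exact (hasDerivAt_rowInner_self_rotRows T hia t A).const_add _

theorem sum_sq_rowInner {A : Matrix (Fin N) (Fin N) ℝ} (hA : A * Aᵀ = 1) (T : Finset (Fin N))
    (i : Fin N) : ∑ a, rowInner T i a A ^ 2 = rowInner T i i A := by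
  have hA' : Aᵀ * A = 1 := mul_eq_one_comm.1 hA
  set x : Fin N → ℝ := fun j => if j ∈ T then A i j else 0 with hx
  have h1 : ∀ a, rowInner T i a A = (A *ᵥ x) a := fun a => by
    simp [rowInner, Matrix.mulVec, dotProduct, hx, mul_comm]
  have h2 : rowInner T i i A = x ⬝ᵥ x := by simp [rowInner, dotProduct, hx]
  have h3 : (A *ᵥ x) ⬝ᵥ (A *ᵥ x) = x ⬝ᵥ x := by
    rw [Matrix.dotProduct_mulVec, Matrix.vecMul_mulVec, hA', Matrix.vecMul_one]
  rw [h2, ← h3]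
  simp only [h1, dotProduct, sq]

theorem sum_rowInner_self {A : Matrix (Fin N) (Fin N) ℝ} (hA : A * Aᵀ = 1)
    (T : Finset (Fin N)) : ∑ a, rowInner T a a A = T.card := by
  have hA' : Aᵀ * A = 1 := mul_eq_one_comm.1 hA
  simp only [rowInner]
  rw [Finset.sum_comm]
  have : ∀ j ∈ T, ∑ a, A a j * A a j = 1 := fun j _ => by
    simpa [Matrix.mul_apply] using congrFun (congrFun hA' j) j
  rw [Finset.sum_congr rfl this]
  simp

theorem sum_rowInner_ge {A : Matrix (Fin N) (Fin N) ℝ} (hA : A * Aᵀ = 1)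
    (S T : Finset (Fin N)) {θ : ℝ} (hθ : 0 ≤ θ) :
    (N - 2 * θ) * blockSq S T A - S.card * T.card ≤
      ∑ i ∈ S, ∑ a ∈ Sᶜ,
        (rowInner T i i A - rowInner T a a A - 2 * θ * rowInner T i a A ^ 2) := by
  have hcol : ∑ a ∈ Sᶜ, rowInner T a a A = T.card - blockSq S T A := by
    rw [← sum_rowInner_self hA T, blockSq, ← Finset.sum_add_sum_compl S]
    ring
  have hsq : ∑ i ∈ S, ∑ a ∈ Sᶜ, rowInner T i a A ^ 2 ≤ blockSq S T A := by
    refine Finset.sum_le_sum fun i _ => ?_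
    rw [← sum_sq_rowInner hA T i]
    exact Finset.sum_le_sum_of_subset_of_nonneg (Finset.subset_univ _) fun _ _ _ => sq_nonneg _
  have hcard : ((Sᶜ).card : ℝ) = N - S.card := by
    rw [Finset.card_compl, Fintype.card_fin, Nat.cast_sub (by simpa using S.card_le_univ)]
  simp only [Finset.sum_sub_distrib, ← Finset.mul_sum, Finset.sum_const, nsmul_eq_mul, hcol,
    hcard]
  change _ ≤ ((N : ℝ) - S.card) * blockSq S T A - _ - _
  nlinarith [mul_le_mul_of_nonneg_left hsq hθ]

variable {μ : Measure (Matrix (Fin N) (Fin N) ℝ)} [IsProbabilityMeasure μ]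

theorem ae_orthogonal (hμ : μ {A | A * Aᵀ = 1} = 1) : ∀ᵐ A ∂μ, A * Aᵀ = 1 :=
  (mem_ae_iff_prob_eq_one measurableSet_orthogonal).2 hμ

theorem abs_rowInner_sub_mul_exp_le (S T : Finset (Fin N)) (i a : Fin N) {θ : ℝ} (hθ : 0 ≤ θ)
    {A : Matrix (Fin N) (Fin N) ℝ} (hA : A * Aᵀ = 1) :
    ‖(rowInner T i i A - rowInner T a a A - 2 * θ * rowInner T i a A ^ 2) *
      Real.exp (θ * blockSq S T A)‖ ≤ (1 + 2 * θ) * Real.exp (θ * S.card) := by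
  rw [norm_mul, Real.norm_eq_abs, Real.norm_eq_abs, Real.abs_exp]
  refine mul_le_mul ?_ ?_ (Real.exp_pos _).le (by positivity)
  · have hw : rowInner T i a A ^ 2 ≤ 1 := (sq_le_one_iff_abs_le_one _).2
      (abs_rowInner_le_one T i a hA)
    have := mul_le_mul_of_nonneg_left hw hθ
    have := mul_nonneg hθ (sq_nonneg (rowInner T i a A))
    rw [abs_le]
    constructor <;>
    linarith [rowInner_self_le_one T i hA, rowInner_self_le_one T a hA,
      rowInner_self_nonneg T i A, rowInner_self_nonneg T a A]
  · exact Real.exp_le_exp.2 (mul_le_mul_of_nonneg_left (blockSq_le S T hA) hθ)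

theorem integrable_rowInner_sub_mul_exp (hμ : μ {A | A * Aᵀ = 1} = 1) (S T : Finset (Fin N))
    (i a : Fin N) {θ : ℝ} (hθ : 0 ≤ θ) :
    Integrable (fun A => (rowInner T i i A - rowInner T a a A - 2 * θ * rowInner T i a A ^ 2) *
      Real.exp (θ * blockSq S T A)) μ := by
  refine Integrable.of_bound (Measurable.aestronglyMeasurable ?_) _
    ((ae_orthogonal hμ).mono fun A hA => abs_rowInner_sub_mul_exp_le S T i a hθ hA)
  exact (((measurable_rowInner T i i).sub (measurable_rowInner T a a)).sub
    (((measurable_rowInner T i a).pow_const 2).const_mul _)).mul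
    ((measurable_blockSq S T).const_mul θ).exp

/-- Integration by parts along the rotations in the plane of the rows `i` and `a`. -/
theorem integral_rowInner_sub_mul_exp (hμ : μ {A | A * Aᵀ = 1} = 1)
    (hinv : ∀ B : Matrix (Fin N) (Fin N) ℝ, B * Bᵀ = 1 → μ.map (fun A => B * A) = μ)
    {S : Finset (Fin N)} (T : Finset (Fin N)) {i a : Fin N} (hi : i ∈ S) (ha : a ∉ S)
    {θ : ℝ} (hθ : 0 ≤ θ) :
    ∫ A, (rowInner T i i A - rowInner T a a A - 2 * θ * rowInner T i a A ^ 2) *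
      Real.exp (θ * blockSq S T A) ∂μ = 0 := by
  have hia : i ≠ a := fun h => ha (h ▸ hi)
  set g : Matrix (Fin N) (Fin N) ℝ → ℝ := fun A =>
    rowInner T i a A * Real.exp (θ * blockSq S T A) with hg
  set g' : Matrix (Fin N) (Fin N) ℝ → ℝ := fun A =>
    (rowInner T i i A - rowInner T a a A - 2 * θ * rowInner T i a A ^ 2) *
      Real.exp (θ * blockSq S T A) with hg'
  have hgm : Measurable g := (measurable_rowInner T i a).mul
    ((measurable_blockSq S T).const_mul θ).exp
  have hgb : ∀ A : Matrix (Fin N) (Fin N) ℝ, A * Aᵀ = 1 → ‖g A‖ ≤ Real.exp (θ * S.card) := by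
    intro A hA
    rw [hg, norm_mul, Real.norm_eq_abs, Real.norm_eq_abs, Real.abs_exp]
    refine (mul_le_of_le_one_left (Real.exp_pos _).le (abs_rowInner_le_one T i a hA)).trans ?_
    exact Real.exp_le_exp.2 (mul_le_mul_of_nonneg_left (blockSq_le S T hA) hθ)
  have hdiff : ∀ A t, HasDerivAt (fun t => g (rotRows i a t A)) (g' (rotRows i a t A)) t := by
    intro A t
    have := (hasDerivAt_rowInner_rotRows T hia t A).mul
      ((hasDerivAt_blockSq_rotRows T hi ha t A).const_mul θ).exp
    refine this.congr_deriv ?_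
    simp only [hg']
    ring
  have hrot0 : ∀ A : Matrix (Fin N) (Fin N) ℝ, rotRows i a 0 A = A := by
    intro A
    ext b j
    by_cases h1 : b = i <;> by_cases h2 : b = a <;> simp_all [rotRows]
  have hg'i : Integrable g' μ := integrable_rowInner_sub_mul_exp hμ S T i a hθ
  have hderiv := (hasDerivAt_integral_of_dominated_loc_of_deriv_le (μ := μ) (x₀ := (0 : ℝ))
    (s := Set.univ) (F := fun t A => g (rotRows i a t A))
    (F' := fun t A => g' (rotRows i a t A))
    (bound := fun _ => (1 + 2 * θ) * Real.exp (θ * S.card)) Filter.univ_mem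
    (Filter.Eventually.of_forall fun t =>
      (hgm.comp (measurable_rotRows i a t)).aestronglyMeasurable)
    (by
      simp only [hrot0]
      exact Integrable.of_bound hgm.aestronglyMeasurable _ ((ae_orthogonal hμ).mono hgb))
    (by
      simp only [hrot0]
      exact hg'i.aestronglyMeasurable)
    ((ae_orthogonal hμ).mono fun A hA t _ =>
      abs_rowInner_sub_mul_exp_le S T i a hθ (rotRows_orthogonal hia t hA))
    (integrable_const _)
    (Filter.Eventually.of_forall fun A t _ => hdiff A t)).2
  have hconst : (fun t => ∫ A, g (rotRows i a t A) ∂μ) = fun _ => ∫ A, g A ∂μ := by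
    ext t
    have hinvt := hinv (rotRows i a t 1) (rotRows_orthogonal hia t (by simp))
    simp only [← rotRows_eq_mul] at hinvt
    conv_rhs => rw [← hinvt]
    exact (integral_map (measurable_rotRows i a t).aemeasurable
      hgm.aestronglyMeasurable).symm
  rw [hconst] at hderiv
  simp only [hrot0] at hderiv
  exact hderiv.unique (hasDerivAt_const _ _)

theorem integrable_exp_blockSq (hμ : μ {A | A * Aᵀ = 1} = 1) (S T : Finset (Fin N)) (θ : ℝ) :
    Integrable (fun A => Real.exp (θ * blockSq S T A)) μ :=
  ProbabilityTheory.integrable_exp_mul_of_mem_Icc (measurable_blockSq S T).aemeasurable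
    ((ae_orthogonal hμ).mono fun _ hA => ⟨blockSq_nonneg S T _, blockSq_le S T hA⟩)

theorem integrableExpSet_blockSq (hμ : μ {A | A * Aᵀ = 1} = 1) (S T : Finset (Fin N)) :
    ProbabilityTheory.integrableExpSet (blockSq S T) μ = Set.univ :=
  Set.eq_univ_of_forall fun θ => integrable_exp_blockSq hμ S T θ

/-- Differential inequality for the moment generating function of `blockSq`. -/
theorem mgf_blockSq_deriv_le (hμ : μ {A | A * Aᵀ = 1} = 1)
    (hinv : ∀ B : Matrix (Fin N) (Fin N) ℝ, B * Bᵀ = 1 → μ.map (fun A => B * A) = μ)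
    (S T : Finset (Fin N)) {θ : ℝ} (hθ : 0 ≤ θ) :
    (N - 2 * θ) * ∫ A, blockSq S T A * Real.exp (θ * blockSq S T A) ∂μ ≤
      S.card * T.card * ProbabilityTheory.mgf (blockSq S T) μ θ := by
  have hint : Integrable (fun A => blockSq S T A * Real.exp (θ * blockSq S T A)) μ := by
    have h := ProbabilityTheory.integrable_pow_mul_exp_of_mem_interior_integrableExpSet
      (X := blockSq S T) (μ := μ) (v := θ) (by simp [integrableExpSet_blockSq hμ]) 1
    simpa using h
  have hexp := integrable_exp_blockSq hμ S T θ
  have hzero : ∫ A, ∑ i ∈ S, ∑ a ∈ Sᶜ,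
      (rowInner T i i A - rowInner T a a A - 2 * θ * rowInner T i a A ^ 2) *
        Real.exp (θ * blockSq S T A) ∂μ = 0 := by
    rw [integral_finsetSum _ fun i _ => integrable_finsetSum _ fun a _ =>
      integrable_rowInner_sub_mul_exp hμ S T i a hθ]
    refine Finset.sum_eq_zero fun i hi => ?_
    rw [integral_finsetSum _ fun a _ => integrable_rowInner_sub_mul_exp hμ S T i a hθ]
    exact Finset.sum_eq_zero fun a ha =>
      integral_rowInner_sub_mul_exp hμ hinv T hi (Finset.mem_compl.1 ha) hθ
  have hle : ∫ A, ((N - 2 * θ) * (blockSq S T A * Real.exp (θ * blockSq S T A)) -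
      S.card * T.card * Real.exp (θ * blockSq S T A)) ∂μ ≤ 0 := by
    rw [← hzero]
    refine integral_mono_ae ((hint.const_mul _).sub (hexp.const_mul _))
      (integrable_finsetSum _ fun i _ => integrable_finsetSum _ fun a _ =>
        integrable_rowInner_sub_mul_exp hμ S T i a hθ)
      ((ae_orthogonal hμ).mono fun A hA => ?_)
    simp only [← Finset.sum_mul]
    refine le_trans (le_of_eq ?_) (mul_le_mul_of_nonneg_right (sum_rowInner_ge hA S T hθ)
      (Real.exp_pos _).le)
    ring
  rw [integral_sub (hint.const_mul _) (hexp.const_mul _), integral_const_mul,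
    integral_const_mul] at hle
  exact sub_nonpos.1 hle

theorem mgf_blockSq_le (hN : 0 < N) (hμ : μ {A | A * Aᵀ = 1} = 1)
    (hinv : ∀ B : Matrix (Fin N) (Fin N) ℝ, B * Bᵀ = 1 → μ.map (fun A => B * A) = μ)
    (S T : Finset (Fin N)) :
    ProbabilityTheory.mgf (blockSq S T) μ (N / 4) ≤ Real.exp (S.card * T.card / 2) := by
  have hN' : (0 : ℝ) < N := Nat.cast_pos.2 hN
  set F := ProbabilityTheory.mgf (blockSq S T) μ with hF
  set q : ℝ := S.card * T.card with hq
  have hFd : ∀ θ, HasDerivAt F (∫ A, blockSq S T A * Real.exp (θ * blockSq S T A) ∂μ) θ :=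
    fun θ => ProbabilityTheory.hasDerivAt_mgf (by simp [integrableExpSet_blockSq hμ])
  set G : ℝ → ℝ := fun θ => F θ * Real.exp (-(2 * q / N) * θ) with hG
  have hGd : ∀ θ, HasDerivAt G
      (((∫ A, blockSq S T A * Real.exp (θ * blockSq S T A) ∂μ) - 2 * q / N * F θ) *
        Real.exp (-(2 * q / N) * θ)) θ := by
    intro θ
    have := (hFd θ).mul (((hasDerivAt_id θ).const_mul (-(2 * q / N))).exp)
    refine this.congr_deriv ?_
    simp only [id]
    ring
  have hanti : AntitoneOn G (Set.Icc 0 (N / 4)) := by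
    refine antitoneOn_of_deriv_nonpos (convex_Icc _ _)
      (fun θ _ => (hGd θ).continuousAt.continuousWithinAt)
      (fun θ _ => (hGd θ).differentiableAt.differentiableWithinAt) fun θ hθ => ?_
    rw [interior_Icc] at hθ
    rw [(hGd θ).deriv]
    refine mul_nonpos_of_nonpos_of_nonneg (sub_nonpos.2 ?_) (Real.exp_pos _).le
    have h1 := mgf_blockSq_deriv_le hμ hinv S T hθ.1.le
    have h2 : 0 ≤ ∫ A, blockSq S T A * Real.exp (θ * blockSq S T A) ∂μ :=
      integral_nonneg fun A => mul_nonneg (blockSq_nonneg S T A) (Real.exp_pos _).le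
    rw [div_mul_eq_mul_div, le_div_iff₀ hN']
    nlinarith [hθ.2]
  have h := hanti (Set.left_mem_Icc.2 (by positivity)) (Set.right_mem_Icc.2 (by positivity))
    (show (0 : ℝ) ≤ N / 4 by positivity)
  have h0 : G 0 = 1 := by simp [hG, hF]
  rw [h0, hG] at h
  simp only at h
  have he : -(2 * q / N) * (N / 4) = -(q / 2) := by
    field_simp
    ring
  rwa [he, Real.exp_neg, ← div_eq_mul_inv, div_le_one (Real.exp_pos _)] at h

theorem measure_blockSq_ge_le (hN : 0 < N) (hμ : μ {A | A * Aᵀ = 1} = 1)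
    (hinv : ∀ B : Matrix (Fin N) (Fin N) ℝ, B * Bᵀ = 1 → μ.map (fun A => B * A) = μ)
    (S T : Finset (Fin N)) (r : ℝ) :
    μ {A | r ≤ N * blockSq S T A} ≤
      ENNReal.ofReal (Real.exp (S.card * T.card / 2 - r / 4)) := by
  have hN' : (0 : ℝ) < N := Nat.cast_pos.2 hN
  have h := ProbabilityTheory.measure_ge_le_exp_mul_mgf (X := blockSq S T) (μ := μ)
    (t := N / 4) (r / N) (by positivity) (integrable_exp_blockSq hμ S T _)
  have hset : {A | r ≤ N * blockSq S T A} = {A | r / N ≤ blockSq S T A} := by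
    ext A
    simp [div_le_iff₀' hN']
  rw [hset, ← ofReal_measureReal]
  refine ENNReal.ofReal_le_ofReal (h.trans ?_)
  refine (mul_le_mul_of_nonneg_left (mgf_blockSq_le hN hμ hinv S T) (Real.exp_pos _).le).trans
    (le_of_eq ?_)
  rw [← Real.exp_add]
  congr 1
  field_simp
  ring

end PlaneRotation

theorem sum_fin_dite_lt {N : ℕ} (m : ℕ) (f : Fin N → ℝ) :
    (∑ i : Fin m, if h : (i : ℕ) < N then f ⟨i, h⟩ else 0) =
      ∑ i with (i : Fin N).val < m, f i := by
  rw [Finset.sum_filter, Finset.sum_fin_eq_sum_range, Finset.sum_fin_eq_sum_range]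
  have h1 : ∀ i ∈ Finset.range m, (if h : i < m then (if h : i < N then f ⟨i, h⟩ else 0) else 0) =
      if i < N then (if h : i < N then f ⟨i, h⟩ else 0) else 0 := by
    intro i hi
    rw [dif_pos (Finset.mem_range.1 hi)]
    split_ifs <;> rfl
  have h2 : ∀ i ∈ Finset.range N, (if h : i < N then (if i < m then f ⟨i, h⟩ else 0) else 0) =
      if i < m then (if h : i < N then f ⟨i, h⟩ else 0) else 0 := by
    intro i hi
    split_ifs <;> rfl
  rw [Finset.sum_congr rfl h1, Finset.sum_congr rfl h2, ← Finset.sum_filter, ← Finset.sum_filter]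
  refine Finset.sum_congr ?_ fun _ _ => rfl
  ext i
  simp [and_comm]

theorem frobSq_smul_blockEmb {N : ℕ} (m k : ℕ) (A : Matrix (Fin N) (Fin N) ℝ) :
    frobSq (Real.sqrt N • blockEmb m k A) =
      N * blockSq {i : Fin N | i.val < m} {j : Fin N | j.val < k} A := by
  have h : ∀ (i : Fin m) (j : Fin k), (Real.sqrt N • blockEmb m k A) i j ^ 2 =
      N * if hi : (i : ℕ) < N then
        (if hj : (j : ℕ) < N then A ⟨i, hi⟩ ⟨j, hj⟩ * A ⟨i, hi⟩ ⟨j, hj⟩ else 0) else 0 := by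
    intro i j
    rw [Matrix.smul_apply, smul_eq_mul, mul_pow, Real.sq_sqrt (Nat.cast_nonneg N), blockEmb,
      Matrix.of_apply]
    by_cases hi : (i : ℕ) < N <;> by_cases hj : (j : ℕ) < N <;> simp [hi, hj, sq]
  simp only [frobSq, h, ← Finset.mul_sum, blockSq, rowInner]
  congr 1
  rw [← sum_fin_dite_lt m]
  refine Finset.sum_congr rfl fun i _ => ?_
  split_ifs with hi
  · exact sum_fin_dite_lt k fun j => A ⟨i, hi⟩ j * A ⟨i, hi⟩ j
  · simp

theorem card_filter_val_lt_le (N m : ℕ) : (Finset.card {i : Fin N | i.val < m} : ℝ) ≤ m := by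
  have h := sum_fin_dite_lt (N := N) m fun _ => 1
  rw [Finset.sum_const, nsmul_eq_mul, mul_one] at h
  rw [← h]
  refine (Finset.sum_le_sum (g := fun _ => (1 : ℝ)) fun i _ => ?_).trans (by simp)
  split_ifs <;> norm_num

theorem log_measure_frobNorm_ge_le {N : ℕ} (hN : 0 < N) (m k : ℕ) {r : ℝ} (hr : 0 < r)
    (μ : Measure (Matrix (Fin N) (Fin N) ℝ)) [IsProbabilityMeasure μ]
    (hμ : μ {A | A * Aᵀ = 1} = 1)
    (hinv : ∀ B : Matrix (Fin N) (Fin N) ℝ, B * Bᵀ = 1 → μ.map (fun A => B * A) = μ) :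
    ENNReal.log (μ {A | r ≤ frobNorm (Real.sqrt N • blockEmb m k A)}) ≤
      ((m * k / 2 - r ^ 2 / 4 : ℝ) : EReal) := by
  have hset : {A : Matrix (Fin N) (Fin N) ℝ | r ≤ frobNorm (Real.sqrt N • blockEmb m k A)} =
      {A | r ^ 2 ≤ N * blockSq {i : Fin N | i.val < m} {j : Fin N | j.val < k} A} := by
    ext A
    rw [Set.mem_ofPred_eq, Set.mem_ofPred_eq, frobNorm, Real.le_sqrt' hr, frobSq_smul_blockEmb]
  rw [hset]
  refine (ENNReal.log_le_log (measure_blockSq_ge_le hN hμ hinv _ _ _)).trans ?_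
  rw [ENNReal.log_ofReal_of_pos (Real.exp_pos _), Real.log_exp, EReal.coe_le_coe_iff]
  have := mul_le_mul (card_filter_val_lt_le N m) (card_filter_val_lt_le N k)
    (Nat.cast_nonneg _) (Nat.cast_nonneg m)
  linarith

/-- **Superexponential concentration of the Frobenius norm of the scaled block**: if
`p_N = m_N k_N = o(N)`, `R_N = o(√N)` and `R_N²/p_N → ∞`, then
`limsup_N (1/p_N) log ℙ(‖√N Z_N‖_F ≥ R_N) = -∞`. Here `μ N` is the Haar probability
measure on `O(N)`, viewed as a measure on `N × N` matrices. -/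
theorem stmt_15
    (m k : ℕ → ℕ)
    (hp_o : (fun N => (m N * k N : ℝ)) =o[atTop] fun N => (N : ℝ))
    (R : ℕ → ℝ) (hR_pos : ∀ N, 0 < R N)
    (hR_o : R =o[atTop] fun N => Real.sqrt N)
    (hR_p : Tendsto (fun N => R N ^ 2 / (m N * k N : ℝ)) atTop atTop)
    (μ : (N : ℕ) → Measure (Matrix (Fin N) (Fin N) ℝ))
    (hμ_prob : ∀ N, IsProbabilityMeasure (μ N))
    (hμ_supp : ∀ N, μ N {A | A * Aᵀ = 1} = 1)
    (hμ_inv : ∀ N (B : Matrix (Fin N) (Fin N) ℝ), B * Bᵀ = 1 →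
      (μ N).map (fun A => B * A) = μ N) :
    Filter.limsup
        (fun N => (((m N * k N : ℝ))⁻¹ : EReal) *
          ENNReal.log (μ N
            {A | R N ≤ frobNorm (Real.sqrt N • blockEmb (m N) (k N) A)})) atTop
      = ⊥ := by
  refine Tendsto.limsup_eq (EReal.tendsto_nhds_bot_iff_real.2 fun x => ?_)
  filter_upwards [hR_p.eventually_gt_atTop (max 0 (2 - 4 * x)), eventually_gt_atTop 0]
    with N hN hN0
  have := hμ_prob N
  have hp : (0 : ℝ) < m N * k N := by
    refine lt_of_le_of_ne (by positivity) fun h => ?_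
    rw [← h, div_zero] at hN
    exact absurd hN (not_lt.2 (le_max_left _ _))
  have hlog := log_measure_frobNorm_ge_le hN0 (m N) (k N) (hR_pos N) (μ N) (hμ_supp N) (hμ_inv N)
  rw [← EReal.coe_inv]
  refine (mul_le_mul_of_nonneg_left hlog (EReal.coe_nonneg.2 (inv_nonneg.2 hp.le))).trans_lt ?_
  rw [← EReal.coe_mul, EReal.coe_lt_coe_iff]
  have h : (m N * k N : ℝ)⁻¹ * (m N * k N / 2 - R N ^ 2 / 4) =
      1 / 2 - R N ^ 2 / (m N * k N) / 4 := by
    generalize (m N * k N : ℝ) = p at hp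
    field_simp
  rw [h]
  linarith [(le_max_right _ _).trans_lt hN]
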